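/- The constructed EEF-EXISTENCE-ADDITIVE instance I' admits an admissible allocation that is both Pareto-optimal and envy-free if and only if there exists an X_∀-assignment s such that the 3CNF formula C is not satisfiable on s (i.e., if and only if it is false that for every truth assignment to X_∀ there exists a truth assignment to X_∃ making every clause of C true). -/

import Mathlib

/-! Construction of the EEF-EXISTENCE-ADDITIVE instance `I'` from a ∀∃3CNF instance.
Universal variables are `Fin p`, existential variables are `Fin q`, and the 3CNF
formula consists of clauses `φ 0, …, φ (k-1)`, each a finite set of literals. -/

/-- A variable: universal (`Sum.inl`) or existential (`Sum.inr`). -/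
abbrev VarE (p q : ℕ) := Fin p ⊕ Fin q

/-- A literal: a variable with a polarity (`true` = positive, `false` = negative). -/
abbrev LitE (p q : ℕ) := VarE p q × Bool

/-- A universal literal, i.e. a literal of a universal variable. -/
abbrev ULitE (p : ℕ) := Fin p × Bool

/-- The literal corresponding to a universal literal. -/
def uLit {p q : ℕ} (l : ULitE p) : LitE p q := (Sum.inl l.1, l.2)

/-- A pair of a clause and a literal occurring in it. -/
abbrev LitOccE (p q k : ℕ) (φ : Fin k → Finset (LitE p q)) :=
  Σ i : Fin k, {l : LitE p q // l ∈ φ i}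

/-- A pair of a clause and a universal literal occurring in it. -/
abbrev ULitOccE (p q k : ℕ) (φ : Fin k → Finset (LitE p q)) :=
  Σ i : Fin k, {l : LitE p q // l ∈ φ i ∧ l.1.isLeft = true}

/-- The agents of `I'`: `a_set(l)` for every literal `l`; `a^h_set(l)` for every
universal literal `l`; `a_c` for every clause `c`; `a^ep_{c,l}` for every clause `c`
and universal literal `l ∈ c`; and the agents `a_un`, `a^ep_un`, `a_sat`. -/
inductive AgentE (p q k : ℕ) (φ : Fin k → Finset (LitE p q)) where
  | aset (l : LitE p q)
  | ah (l : ULitE p)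
  | ac (i : Fin k)
  | aep (e : ULitOccE p q k φ)
  | aun
  | aepun
  | asat
deriving DecidableEq, Fintype

/-- The resources of `I'`: for each universal variable `x`, `o_x`, `o^comp_x` and the
two helper resources `o^h_set(x)`, `o^h_set(¬x)`; for each existential variable `y`,
`o_y`; for each clause `c`, `o_c` and `o^comp_c`; for each clause `c` and literal
`l ∈ c`, `o_{c,l}`; for each clause `c` and universal literal `l ∈ c`, `o^ep_{c,l}`;
and the resources `o_sat`, `o_envy1`, `o_envy2`. -/
inductive ResE (p q k : ℕ) (φ : Fin k → Finset (LitE p q)) where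
  | ovar (x : Fin p)
  | ocomp (x : Fin p)
  | oh (l : ULitE p)
  | oevar (y : Fin q)
  | ocl (i : Fin k)
  | occomp (i : Fin k)
  | olit (e : LitOccE p q k φ)
  | oep (e : ULitOccE p q k φ)
  | osat
  | oenvy1
  | oenvy2
deriving DecidableEq, Fintype

/-- `|C_l|`: the number of clauses containing the literal `l`, as a real number. -/
noncomputable def occE (p q k : ℕ) (φ : Fin k → Finset (LitE p q)) (l : LitE p q) : ℝ :=
  ((Finset.univ.filter fun i => l ∈ φ i).card : ℝ)

/-- The utility coefficients of `I'`, presented as pairs `(c, μ)` standing for the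
coefficient `c + μ * M`, where `M` is the large constant.  A coefficient is a
"non-`M` coefficient" exactly when `μ = 0`. -/
noncomputable def coeffAuxE (p q k : ℕ) (φ : Fin k → Finset (LitE p q)) :
    AgentE p q k φ → ResE p q k φ → ℝ × ℝ
  -- agents a_set(l)
  | .aset l, .ovar x => (if l.1 = Sum.inl x then 1 else 0, 0)
  | .aset l, .ocomp x => (if l.1 = Sum.inl x then 1 else 0, 0)
  | .aset l, .oh hl => (if l.1 = Sum.inl hl.1 then 1 else 0, 0)
  | .aset l, .oevar y => (if l.1 = Sum.inr y then occE p q k φ l else 0, 0)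
  | .aset l, .olit ⟨_, l'⟩ =>
      (if (l' : LitE p q) = l ∧ l.1.isRight = true then 1 else 0, 0)
  -- agents a^h_set(l)
  | .ah hl, .oh hl' => (if hl' = hl then occE p q k φ (uLit hl) else 0, 0)
  | .ah hl, .olit ⟨_, l'⟩ => (if (l' : LitE p q) = uLit hl then 1 else 0, 0)
  -- agents a_c
  | .ac i, .ocl i' => (0, if i' = i then 1 else 0)
  | .ac i, .occomp i' => (if i' = i then -1 else 0, if i' = i then 1 else 0)
  | .ac i, .olit ⟨i', _⟩ => (if i' = i then 1 else 0, 0)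
  -- agents a^ep_{c,l}
  | .aep ⟨i, l⟩, .ocl i' => (0, if i' = i then 1 else 0)
  | .aep ⟨i, l⟩, .olit ⟨i', l'⟩ =>
      (if i' = i ∧ (l' : LitE p q) = (l : LitE p q) then 1 else 0, 0)
  | .aep ⟨i, l⟩, .oep ⟨i', l'⟩ =>
      (0, if i' = i ∧ (l' : LitE p q) = (l : LitE p q) then 1 else 0)
  -- agent a_un
  | .aun, .ocomp _ => (1, 0)
  | .aun, .oevar _ => (1, 0)
  | .aun, .occomp _ => (1, 0)
  | .aun, .osat => ((q : ℝ) + (p : ℝ) + (k : ℝ) + 1, 0)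
  | .aun, .oenvy1 => (2 * ((q : ℝ) + (p : ℝ) + (k : ℝ) + 1), 0)
  | .aun, .oenvy2 =>
      (2 * ((q : ℝ) + (p : ℝ) + (k : ℝ) + 1) + ((q : ℝ) + (p : ℝ) + (k : ℝ)), 0)
  -- agent a^ep_un
  | .aepun, .oenvy2 => (0, 1)
  -- agent a_sat
  | .asat, .ocl _ => (1, 0)
  | .asat, .osat => ((k : ℝ), 0)
  | .asat, .oenvy1 => (1 / 2, 0)
  | _, _ => (0, 0)

/-- The utility coefficients of `I'` for a given value of the large constant `M`. -/
noncomputable def coeffE (p q k : ℕ) (φ : Fin k → Finset (LitE p q)) (M : ℝ)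
    (A : AgentE p q k φ) (o : ResE p q k φ) : ℝ :=
  (coeffAuxE p q k φ A o).1 + (coeffAuxE p q k φ A o).2 * M

/-- The sum of all non-`M` coefficients of `I'` (those whose `M`-multiplier is `0`). -/
noncomputable def nonMSumE (p q k : ℕ) (φ : Fin k → Finset (LitE p q)) : ℝ :=
  ∑ A : AgentE p q k φ, ∑ o : ResE p q k φ,
    if (coeffAuxE p q k φ A o).2 = 0 then (coeffAuxE p q k φ A o).1 else 0

/-- The utility that agent `i` assigns to the bundle held by agent `j` under an
allocation (an allocation maps each resource to at most one agent, hence is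
automatically admissible). -/
noncomputable def utilE (p q k : ℕ) (φ : Fin k → Finset (LitE p q)) (M : ℝ)
    (al : ResE p q k φ → Option (AgentE p q k φ)) (i j : AgentE p q k φ) : ℝ :=
  ∑ o : ResE p q k φ, if al o = some j then coeffE p q k φ M i o else 0

/-- Envy-freeness: every agent values its own bundle at least as much as the bundle of
any other agent. -/
def EnvyFreeE (p q k : ℕ) (φ : Fin k → Finset (LitE p q)) (M : ℝ)
    (al : ResE p q k φ → Option (AgentE p q k φ)) : Prop :=
  ∀ i j : AgentE p q k φ, utilE p q k φ M al i j ≤ utilE p q k φ M al i i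

/-- `a'` Pareto-dominates `a`: no agent's utility decreases, some agent's utility
strictly increases. -/
def DominatesE (p q k : ℕ) (φ : Fin k → Finset (LitE p q)) (M : ℝ)
    (a' a : ResE p q k φ → Option (AgentE p q k φ)) : Prop :=
  (∀ A, utilE p q k φ M a A A ≤ utilE p q k φ M a' A A) ∧
  ∃ A, utilE p q k φ M a A A < utilE p q k φ M a' A A

/-- Pareto optimality (efficiency): no admissible allocation Pareto-dominates `a`. -/
def ParetoOptE (p q k : ℕ) (φ : Fin k → Finset (LitE p q)) (M : ℝ)
    (a : ResE p q k φ → Option (AgentE p q k φ)) : Prop :=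
  ¬ ∃ a' : ResE p q k φ → Option (AgentE p q k φ), DominatesE p q k φ M a' a

/-- `C` is satisfiable on the `X_∀`-assignment `s` if some assignment `t` of the
existential variables, together with `s`, makes every clause true. -/
def SatOnE (p q k : ℕ) (φ : Fin k → Finset (LitE p q)) (s : Fin p → Bool) : Prop :=
  ∃ t : Fin q → Bool, ∀ i : Fin k, ∃ l ∈ φ i, Sum.elim s t l.1 = l.2

/-- `al` is an `X_∀`-allocation corresponding to the `X_∀`-assignment `s`. -/
def IsXAllocE (p q k : ℕ) (φ : Fin k → Finset (LitE p q)) (s : Fin p → Bool)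
    (al : ResE p q k φ → Option (AgentE p q k φ)) : Prop :=
  -- each o_c goes to a_c
  (∀ i : Fin k, al (.ocl i) = some (.ac i)) ∧
  -- each existential literal resource o_{c,l} goes to a_set(l)
  (∀ i : Fin k, ∀ l : {l : LitE p q // l ∈ φ i}, (l : LitE p q).1.isRight = true →
      al (.olit ⟨i, l⟩) = some (.aset l)) ∧
  -- for each universal variable x, o_x goes to one of a_set(x), a_set(¬x), and the two
  -- helper resources are placed according to the truth value of x under s
  (∀ x : Fin p, ∃ b : Bool,
      al (.ovar x) = some (.aset (Sum.inl x, b)) ∧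
      (s x = true →
        al (.oh (x, true)) = some (.aset (Sum.inl x, !b)) ∧
        al (.oh (x, false)) = some (.ah (x, !b))) ∧
      (s x = false →
        al (.oh (x, true)) = some (.ah (x, !b)) ∧
        al (.oh (x, false)) = some (.aset (Sum.inl x, !b)))) ∧
  -- each o^ep_{c,l} goes to a^ep_{c,l}
  (∀ e : ULitOccE p q k φ, al (.oep e) = some (.aep e)) ∧
  -- a_un receives all existential variable resources, all clause compensation
  -- resources, all universal variable compensation resources, and o_envy1
  (∀ y : Fin q, al (.oevar y) = some .aun) ∧
  (∀ i : Fin k, al (.occomp i) = some .aun) ∧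
  (∀ x : Fin p, al (.ocomp x) = some .aun) ∧
  al .oenvy1 = some .aun ∧
  -- o_envy2 goes to a^ep_un and o_sat goes to a_sat
  al .oenvy2 = some .aepun ∧
  al .osat = some .asat ∧
  -- each universal literal resource o_{c,l} goes to a^h_set(l) if l is true under s,
  -- and to either a^ep_{c,l} or a^h_set(l) if l is false under s
  (∀ e : ULitOccE p q k φ, ∀ x : Fin p, ∀ b : Bool,
      (e.2 : LitE p q) = (Sum.inl x, b) →
      ((s x = b → al (.olit ⟨e.1, ⟨e.2.1, e.2.2.1⟩⟩) = some (.ah (x, b))) ∧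
       (s x ≠ b →
         (al (.olit ⟨e.1, ⟨e.2.1, e.2.2.1⟩⟩) = some (.ah (x, b)) ∨
          al (.olit ⟨e.1, ⟨e.2.1, e.2.2.1⟩⟩) = some (.aep e)))))

/-- `al` is an `X_∀`-allocation: it corresponds to some `X_∀`-assignment. -/
def IsXAllocSomeE (p q k : ℕ) (φ : Fin k → Finset (LitE p q))
    (al : ResE p q k φ → Option (AgentE p q k φ)) : Prop :=
  ∃ s : Fin p → Bool, IsXAllocE p q k φ s al

section Utilities

variable {p q k : ℕ} {φ : Fin k → Finset (LitE p q)}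

/-- The indicator, as a real number, of agent `j` holding resource `o` under `al`. -/
noncomputable def shareE (al : ResE p q k φ → Option (AgentE p q k φ)) (o : ResE p q k φ)
    (j : AgentE p q k φ) : ℝ :=
  if al o = some j then 1 else 0

theorem shareE_nonneg (al : ResE p q k φ → Option (AgentE p q k φ)) (o : ResE p q k φ)
    (j : AgentE p q k φ) : 0 ≤ shareE al o j := by
  unfold shareE; split_ifs <;> norm_num

theorem shareE_le_one (al : ResE p q k φ → Option (AgentE p q k φ)) (o : ResE p q k φ)
    (j : AgentE p q k φ) : shareE al o j ≤ 1 := by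
  unfold shareE; split_ifs <;> norm_num

theorem shareE_eq_one {al : ResE p q k φ → Option (AgentE p q k φ)} {o : ResE p q k φ}
    {j : AgentE p q k φ} (h : al o = some j) : shareE al o j = 1 := if_pos h

theorem shareE_eq_zero {al : ResE p q k φ → Option (AgentE p q k φ)} {o : ResE p q k φ}
    {j : AgentE p q k φ} (h : al o ≠ some j) : shareE al o j = 0 := if_neg h

theorem shareE_eq_zero_of_ne {al : ResE p q k φ → Option (AgentE p q k φ)} {o : ResE p q k φ}
    {i j : AgentE p q k φ} (h : al o = some i) (hij : i ≠ j) : shareE al o j = 0 :=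
  shareE_eq_zero fun h' => hij (Option.some.inj (h.symm.trans h'))

theorem eq_some_of_shareE_pos {al : ResE p q k φ → Option (AgentE p q k φ)}
    {o : ResE p q k φ} {j : AgentE p q k φ} (h : 0 < shareE al o j) : al o = some j := by
  by_contra hne
  rw [shareE_eq_zero hne] at h
  exact lt_irrefl _ h

/-- The number of resources `o_{c,l}`, for a fixed literal `l`, held by agent `j`. -/
noncomputable def litShareE (al : ResE p q k φ → Option (AgentE p q k φ)) (l : LitE p q)
    (j : AgentE p q k φ) : ℝ :=
  ∑ e : LitOccE p q k φ, if (e.2 : LitE p q) = l then shareE al (.olit e) j else 0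

/-- The number of resources `o_{c,l}`, for a fixed clause `c`, held by agent `j`. -/
noncomputable def clauseShareE (al : ResE p q k φ → Option (AgentE p q k φ)) (i : Fin k)
    (j : AgentE p q k φ) : ℝ :=
  ∑ e : LitOccE p q k φ, if e.1 = i then shareE al (.olit e) j else 0

/-- The resources as a disjoint union of their kinds. -/
def resEquivE (p q k : ℕ) (φ : Fin k → Finset (LitE p q)) :
    ResE p q k φ ≃ (((((((((Fin p ⊕ Fin p) ⊕ ULitE p) ⊕ Fin q) ⊕ Fin k) ⊕ Fin k) ⊕
      LitOccE p q k φ) ⊕ ULitOccE p q k φ) ⊕ Unit) ⊕ Unit) ⊕ Unit where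
  toFun
    | .ovar x => .inl (.inl (.inl (.inl (.inl (.inl (.inl (.inl (.inl (.inl x)))))))))
    | .ocomp x => .inl (.inl (.inl (.inl (.inl (.inl (.inl (.inl (.inl (.inr x)))))))))
    | .oh l => .inl (.inl (.inl (.inl (.inl (.inl (.inl (.inl (.inr l))))))))
    | .oevar y => .inl (.inl (.inl (.inl (.inl (.inl (.inl (.inr y)))))))
    | .ocl i => .inl (.inl (.inl (.inl (.inl (.inl (.inr i))))))
    | .occomp i => .inl (.inl (.inl (.inl (.inl (.inr i)))))
    | .olit e => .inl (.inl (.inl (.inl (.inr e))))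
    | .oep e => .inl (.inl (.inl (.inr e)))
    | .osat => .inl (.inl (.inr ()))
    | .oenvy1 => .inl (.inr ())
    | .oenvy2 => .inr ()
  invFun
    | .inl (.inl (.inl (.inl (.inl (.inl (.inl (.inl (.inl (.inl x))))))))) => .ovar x
    | .inl (.inl (.inl (.inl (.inl (.inl (.inl (.inl (.inl (.inr x))))))))) => .ocomp x
    | .inl (.inl (.inl (.inl (.inl (.inl (.inl (.inl (.inr l)))))))) => .oh l
    | .inl (.inl (.inl (.inl (.inl (.inl (.inl (.inr y))))))) => .oevar y
    | .inl (.inl (.inl (.inl (.inl (.inl (.inr i)))))) => .ocl i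
    | .inl (.inl (.inl (.inl (.inl (.inr i))))) => .occomp i
    | .inl (.inl (.inl (.inl (.inr e)))) => .olit e
    | .inl (.inl (.inl (.inr e))) => .oep e
    | .inl (.inl (.inr ())) => .osat
    | .inl (.inr ()) => .oenvy1
    | .inr () => .oenvy2
  left_inv o := by cases o <;> rfl
  right_inv o := by
    rcases o with (((((((((x | x) | l) | y) | i) | i) | e) | e) | u) | u) | u <;> rfl

theorem sum_resE (f : ResE p q k φ → ℝ) :
    ∑ o, f o = ∑ x, f (.ovar x) + ∑ x, f (.ocomp x) + ∑ l, f (.oh l) + ∑ y, f (.oevar y) +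
      ∑ i, f (.ocl i) + ∑ i, f (.occomp i) + ∑ e, f (.olit e) + ∑ e, f (.oep e) +
      f .osat + f .oenvy1 + f .oenvy2 := by
  rw [← (resEquivE p q k φ).symm.sum_comp f]
  simp only [Fintype.sum_sum_type, Fintype.sum_unique]
  rfl

theorem utilE_eq_sum (M : ℝ) (al : ResE p q k φ → Option (AgentE p q k φ))
    (i j : AgentE p q k φ) :
    utilE p q k φ M al i j = ∑ o, coeffE p q k φ M i o * shareE al o j := by
  simp [utilE, shareE]

theorem utilE_aset_inl (M : ℝ) (al : ResE p q k φ → Option (AgentE p q k φ))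
    (x : Fin p) (b : Bool) (j : AgentE p q k φ) :
    utilE p q k φ M al (.aset (Sum.inl x, b)) j =
      shareE al (.ovar x) j + shareE al (.ocomp x) j + shareE al (.oh (x, true)) j +
        shareE al (.oh (x, false)) j := by
  rw [utilE_eq_sum, sum_resE]
  simp [coeffE, coeffAuxE, Fintype.sum_prod_type, Finset.sum_add_distrib]
  ring

theorem utilE_aset_inr (M : ℝ) (al : ResE p q k φ → Option (AgentE p q k φ))
    (y : Fin q) (b : Bool) (j : AgentE p q k φ) :
    utilE p q k φ M al (.aset (Sum.inr y, b)) j =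
      occE p q k φ (Sum.inr y, b) * shareE al (.oevar y) j +
        litShareE al (Sum.inr y, b) j := by
  rw [utilE_eq_sum, sum_resE]
  simp [coeffE, coeffAuxE, litShareE]

theorem utilE_ah (M : ℝ) (al : ResE p q k φ → Option (AgentE p q k φ))
    (l : ULitE p) (j : AgentE p q k φ) :
    utilE p q k φ M al (.ah l) j =
      occE p q k φ (uLit l) * shareE al (.oh l) j + litShareE al (uLit l) j := by
  rw [utilE_eq_sum, sum_resE]
  simp [coeffE, coeffAuxE, litShareE]

theorem utilE_ac (M : ℝ) (al : ResE p q k φ → Option (AgentE p q k φ))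
    (i : Fin k) (j : AgentE p q k φ) :
    utilE p q k φ M al (.ac i) j =
      M * shareE al (.ocl i) j + (M - 1) * shareE al (.occomp i) j +
        clauseShareE al i j := by
  rw [utilE_eq_sum, sum_resE]
  have h (x : Fin k) : (((if x = i then (-1 : ℝ) else 0) + if x = i then M else 0) *
      shareE al (.occomp x) j) = if x = i then (M - 1) * shareE al (.occomp x) j else 0 := by
    split_ifs <;> ring
  simp [coeffE, coeffAuxE, clauseShareE, h]

theorem utilE_aep (M : ℝ) (al : ResE p q k φ → Option (AgentE p q k φ))
    (e : ULitOccE p q k φ) (j : AgentE p q k φ) :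
    utilE p q k φ M al (.aep e) j =
      M * shareE al (.ocl e.1) j + shareE al (.olit ⟨e.1, ⟨e.2.1, e.2.2.1⟩⟩) j +
        M * shareE al (.oep e) j := by
  obtain ⟨i, l⟩ := e
  rw [utilE_eq_sum, sum_resE]
  have hlit : ∑ e : LitOccE p q k φ,
      coeffE p q k φ M (.aep ⟨i, l⟩) (.olit e) * shareE al (.olit e) j =
        shareE al (.olit ⟨i, ⟨l.1, l.2.1⟩⟩) j := by
    rw [Fintype.sum_eq_single ⟨i, ⟨l.1, l.2.1⟩⟩]
    · simp [coeffE, coeffAuxE]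
    · rintro ⟨i', l'⟩ hne
      have : ¬ (i' = i ∧ (l' : LitE p q) = l) := by
        rintro ⟨rfl, h⟩
        exact hne (by congr 1; exact Subtype.ext h)
      simp [coeffE, coeffAuxE, this]
  have hep : ∑ e : ULitOccE p q k φ,
      coeffE p q k φ M (.aep ⟨i, l⟩) (.oep e) * shareE al (.oep e) j =
        M * shareE al (.oep ⟨i, l⟩) j := by
    rw [Fintype.sum_eq_single ⟨i, l⟩]
    · simp [coeffE, coeffAuxE]
    · rintro ⟨i', l'⟩ hne
      have : ¬ (i' = i ∧ (l' : LitE p q) = l) := by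
        rintro ⟨rfl, h⟩
        exact hne (by congr 1; exact Subtype.ext h)
      simp [coeffE, coeffAuxE, this]
  rw [hlit, hep]
  simp [coeffE, coeffAuxE]

theorem utilE_aun (M : ℝ) (al : ResE p q k φ → Option (AgentE p q k φ))
    (j : AgentE p q k φ) :
    utilE p q k φ M al .aun j =
      ∑ x, shareE al (.ocomp x) j + ∑ y, shareE al (.oevar y) j +
        ∑ i, shareE al (.occomp i) j + ((q : ℝ) + p + k + 1) * shareE al .osat j +
        2 * ((q : ℝ) + p + k + 1) * shareE al .oenvy1 j +
        (2 * ((q : ℝ) + p + k + 1) + ((q : ℝ) + p + k)) * shareE al .oenvy2 j := by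
  rw [utilE_eq_sum, sum_resE]
  simp [coeffE, coeffAuxE]

theorem utilE_aepun (M : ℝ) (al : ResE p q k φ → Option (AgentE p q k φ))
    (j : AgentE p q k φ) :
    utilE p q k φ M al .aepun j = M * shareE al .oenvy2 j := by
  rw [utilE_eq_sum, sum_resE]
  simp [coeffE, coeffAuxE]

theorem utilE_asat (M : ℝ) (al : ResE p q k φ → Option (AgentE p q k φ))
    (j : AgentE p q k φ) :
    utilE p q k φ M al .asat j =
      ∑ i, shareE al (.ocl i) j + (k : ℝ) * shareE al .osat j +
        1 / 2 * shareE al .oenvy1 j := by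
  rw [utilE_eq_sum, sum_resE]
  simp [coeffE, coeffAuxE]

theorem sum_shareE_nonneg {ι : Type*} [Fintype ι]
    (al : ResE p q k φ → Option (AgentE p q k φ)) (g : ι → ResE p q k φ)
    (j : AgentE p q k φ) : 0 ≤ ∑ x, shareE al (g x) j :=
  Finset.sum_nonneg fun _ _ => shareE_nonneg _ _ _

theorem sum_shareE_le {n : ℕ} (al : ResE p q k φ → Option (AgentE p q k φ))
    (g : Fin n → ResE p q k φ) (j : AgentE p q k φ) :
    ∑ x, shareE al (g x) j ≤ n := by
  calc ∑ x, shareE al (g x) j ≤ ∑ _x : Fin n, (1 : ℝ) :=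
        Finset.sum_le_sum fun _ _ => shareE_le_one _ _ _
    _ = n := by simp

theorem eq_some_of_le_sum_shareE {n : ℕ} {al : ResE p q k φ → Option (AgentE p q k φ)}
    {g : Fin n → ResE p q k φ} {j : AgentE p q k φ} (h : (n : ℝ) ≤ ∑ x, shareE al (g x) j)
    (x : Fin n) : al (g x) = some j := by
  by_contra hne
  have hlt : ∑ x, shareE al (g x) j < ∑ _x : Fin n, (1 : ℝ) :=
    Finset.sum_lt_sum (fun _ _ => shareE_le_one _ _ _)
      ⟨x, Finset.mem_univ _, by rw [shareE_eq_zero hne]; norm_num⟩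
  simp at hlt
  linarith

theorem sum_shareE_eq_zero {ι : Type*} [Fintype ι]
    {al : ResE p q k φ → Option (AgentE p q k φ)} {g : ι → ResE p q k φ}
    {j : AgentE p q k φ} (h : ∀ x, al (g x) ≠ some j) : ∑ x, shareE al (g x) j = 0 :=
  Finset.sum_eq_zero fun x _ => shareE_eq_zero (h x)

theorem occE_eq_sum (l : LitE p q) :
    occE p q k φ l = ∑ e : LitOccE p q k φ, if (e.2 : LitE p q) = l then 1 else 0 := by
  rw [Fintype.sum_sigma, occE, Finset.card_filter]
  push_cast
  refine Finset.sum_congr rfl fun i _ => ?_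
  rw [Finset.sum_coe_sort (φ i) (fun l' : LitE p q => if l' = l then (1 : ℝ) else 0)]
  simp

theorem occE_nonneg (l : LitE p q) : 0 ≤ occE p q k φ l := Nat.cast_nonneg _

theorem occE_pos {l : LitE p q} (h : ∃ i, l ∈ φ i) : 0 < occE p q k φ l := by
  obtain ⟨i, hi⟩ := h
  exact Nat.cast_pos.2 (Finset.card_pos.2 ⟨i, by simpa using hi⟩)

theorem litShareE_nonneg (al : ResE p q k φ → Option (AgentE p q k φ)) (l : LitE p q)
    (j : AgentE p q k φ) : 0 ≤ litShareE al l j :=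
  Finset.sum_nonneg fun e _ => by split_ifs <;> simp [shareE_nonneg]

theorem litShareE_le (al : ResE p q k φ → Option (AgentE p q k φ)) (l : LitE p q)
    (j : AgentE p q k φ) : litShareE al l j ≤ occE p q k φ l := by
  rw [occE_eq_sum]
  exact Finset.sum_le_sum fun e _ => by split_ifs <;> simp [shareE_le_one]

theorem litShareE_eq_occE {al : ResE p q k φ → Option (AgentE p q k φ)} {l : LitE p q}
    {j : AgentE p q k φ} (h : ∀ e : LitOccE p q k φ, (e.2 : LitE p q) = l →
      al (.olit e) = some j) : litShareE al l j = occE p q k φ l := by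
  rw [occE_eq_sum]
  refine Finset.sum_congr rfl fun e _ => ?_
  split_ifs with he
  · exact shareE_eq_one (h e he)
  · rfl

theorem litShareE_eq_zero {al : ResE p q k φ → Option (AgentE p q k φ)} {l : LitE p q}
    {j : AgentE p q k φ} (h : ∀ e : LitOccE p q k φ, (e.2 : LitE p q) = l →
      al (.olit e) ≠ some j) : litShareE al l j = 0 :=
  Finset.sum_eq_zero fun e _ => by
    split_ifs with he
    · exact shareE_eq_zero (h e he)
    · rfl

theorem eq_some_of_occE_le {al : ResE p q k φ → Option (AgentE p q k φ)} {l : LitE p q}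
    {j : AgentE p q k φ} (h : occE p q k φ l ≤ litShareE al l j)
    (e : LitOccE p q k φ) (he : (e.2 : LitE p q) = l) : al (.olit e) = some j := by
  by_contra hne
  refine absurd h (not_le.2 ?_)
  rw [occE_eq_sum]
  refine Finset.sum_lt_sum (fun e _ => ?_) ⟨e, Finset.mem_univ _, ?_⟩
  · split_ifs <;> simp [shareE_le_one]
  · simp [he, shareE_eq_zero hne]

theorem clauseShareE_nonneg (al : ResE p q k φ → Option (AgentE p q k φ)) (i : Fin k)
    (j : AgentE p q k φ) : 0 ≤ clauseShareE al i j :=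
  Finset.sum_nonneg fun e _ => by split_ifs <;> simp [shareE_nonneg]

theorem clauseShareE_le (al : ResE p q k φ → Option (AgentE p q k φ)) (i : Fin k)
    (j : AgentE p q k φ) : clauseShareE al i j ≤ (φ i).card := by
  calc clauseShareE al i j ≤ ∑ e : LitOccE p q k φ, if e.1 = i then (1 : ℝ) else 0 :=
        Finset.sum_le_sum fun e _ => by split_ifs <;> simp [shareE_le_one]
    _ = (φ i).card := by
        rw [Fintype.sum_sigma]
        simp [apply_ite]

theorem clauseShareE_eq_zero {al : ResE p q k φ → Option (AgentE p q k φ)} {i : Fin k}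
    {j : AgentE p q k φ} (h : ∀ e : LitOccE p q k φ, e.1 = i → al (.olit e) ≠ some j) :
    clauseShareE al i j = 0 :=
  Finset.sum_eq_zero fun e _ => by
    split_ifs with he
    · exact shareE_eq_zero (h e he)
    · rfl

theorem coeffAuxE_nonneg_of_snd_eq_zero (A : AgentE p q k φ) (o : ResE p q k φ)
    (h : (coeffAuxE p q k φ A o).2 = 0) : 0 ≤ (coeffAuxE p q k φ A o).1 := by
  rcases A with l | l | i | ⟨i, l⟩ | _ | _ | _ <;>
    rcases o with x | x | l' | y | i' | i' | ⟨i', l'⟩ | ⟨i', l'⟩ | _ | _ | _ <;>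
    simp only [coeffAuxE] at h ⊢ <;> (try split_ifs at h ⊢) <;>
    first | positivity | exact occE_nonneg _ | simp_all

theorem five_lt_of_nonMSumE_lt {M : ℝ} (hM : nonMSumE p q k φ < M) : 5 < M := by
  have hterm (A : AgentE p q k φ) (o : ResE p q k φ) :
      0 ≤ if (coeffAuxE p q k φ A o).2 = 0 then (coeffAuxE p q k φ A o).1 else 0 := by
    split_ifs with h
    · exact coeffAuxE_nonneg_of_snd_eq_zero A o h
    · exact le_rfl
  have hrow : (∑ o : ResE p q k φ, if (coeffAuxE p q k φ .aun o).2 = 0 then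
      (coeffAuxE p q k φ .aun o).1 else 0) ≤ nonMSumE p q k φ :=
    Finset.single_le_sum (f := fun A => ∑ o : ResE p q k φ,
      if (coeffAuxE p q k φ A o).2 = 0 then (coeffAuxE p q k φ A o).1 else 0)
      (fun A _ => Finset.sum_nonneg fun o _ => hterm A o) (Finset.mem_univ _)
  rw [sum_resE] at hrow
  simp [coeffAuxE] at hrow
  have hp : (0 : ℝ) ≤ p := Nat.cast_nonneg _
  have hq : (0 : ℝ) ≤ q := Nat.cast_nonneg _
  have hk : (0 : ℝ) ≤ k := Nat.cast_nonneg _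
  linarith

end Utilities

section UnsatToEEF

variable {p q k : ℕ} {φ : Fin k → Finset (LitE p q)}

/-- An `X_∀`-allocation corresponding to `s` in which each universal literal resource `o_{c,l}`
goes to `a^h_set(l)`. -/
def xAllocE (s : Fin p → Bool) : ResE p q k φ → Option (AgentE p q k φ)
  | .ovar x => some (.aset (Sum.inl x, s x))
  | .ocomp _ => some .aun
  | .oh l => if s l.1 = l.2 then some (.aset (Sum.inl l.1, !l.2)) else some (.ah l)
  | .oevar _ => some .aun
  | .ocl i => some (.ac i)
  | .occomp _ => some .aun
  | .olit ⟨_, ⟨(Sum.inl x, b), _⟩⟩ => some (.ah (x, b))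
  | .olit ⟨_, ⟨(Sum.inr y, b), _⟩⟩ => some (.aset (Sum.inr y, b))
  | .oep e => some (.aep e)
  | .osat => some .asat
  | .oenvy1 => some .aun
  | .oenvy2 => some .aepun

/-- The utility of each agent under `xAllocE s`. -/
noncomputable def xAllocUtilE (p q k : ℕ) (φ : Fin k → Finset (LitE p q)) (M : ℝ)
    (s : Fin p → Bool) : AgentE p q k φ → ℝ
  | .aset (Sum.inl _, _) => 1
  | .aset (Sum.inr y, b) => occE p q k φ (Sum.inr y, b)
  | .ah l => if s l.1 = l.2 then occE p q k φ (uLit l) else 2 * occE p q k φ (uLit l)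
  | .ac _ => M
  | .aep _ => M
  | .aun => 2 * ((q : ℝ) + p + k + 1) + ((q : ℝ) + p + k)
  | .aepun => M
  | .asat => k

theorem xAllocE_olit_inl (s : Fin p → Bool) (e : LitOccE p q k φ) {x : Fin p} {b : Bool}
    (h : (e.2 : LitE p q) = (Sum.inl x, b)) : xAllocE s (.olit e) = some (.ah (x, b)) := by
  obtain ⟨i, ⟨l, hl⟩⟩ := e
  subst h
  rfl

theorem xAllocE_olit_inr (s : Fin p → Bool) (e : LitOccE p q k φ) {y : Fin q} {b : Bool}
    (h : (e.2 : LitE p q) = (Sum.inr y, b)) :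
    xAllocE s (.olit e) = some (.aset (Sum.inr y, b)) := by
  obtain ⟨i, ⟨l, hl⟩⟩ := e
  subst h
  rfl

theorem xAllocE_olit_ne (s : Fin p → Bool) (e : LitOccE p q k φ) {A : AgentE p q k φ}
    (hset : ∀ l, A ≠ .aset l) (hh : ∀ l, A ≠ .ah l) : xAllocE s (.olit e) ≠ some A := by
  obtain ⟨i, ⟨⟨x | y, b⟩, hl⟩⟩ := e
  · simpa [xAllocE] using (hh (x, b)).symm
  · simpa [xAllocE] using (hset (Sum.inr y, b)).symm

theorem xAllocUtilE_le_utilE {M : ℝ} (s : Fin p → Bool) (A : AgentE p q k φ) :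
    xAllocUtilE p q k φ M s A ≤ utilE p q k φ M (xAllocE s) A A := by
  rcases A with ⟨x | y, b⟩ | ⟨x, b⟩ | i | e | _ | _ | _
  · rw [utilE_aset_inl]
    cases b <;> cases hs : s x <;> simp [xAllocUtilE, shareE, xAllocE, hs]
  · rw [utilE_aset_inr, litShareE_eq_occE fun e he => xAllocE_olit_inr s e he]
    simp [xAllocUtilE, shareE, xAllocE]
  · rw [utilE_ah, litShareE_eq_occE (l := uLit (x, b)) fun e he => xAllocE_olit_inl s e he]
    by_cases hs : s x = b <;> simp [xAllocUtilE, shareE, xAllocE, hs]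
    linarith
  · rw [utilE_ac]
    have := clauseShareE_nonneg (xAllocE (φ := φ) s) i (.ac i)
    simp [xAllocUtilE, shareE, xAllocE]
    exact this
  · rw [utilE_aep]
    have := shareE_nonneg (xAllocE s) (.olit ⟨e.1, ⟨e.2.1, e.2.2.1⟩⟩) (.aep e)
    have h1 : shareE (xAllocE s) (.ocl e.1) (.aep e) = 0 := by simp [shareE, xAllocE]
    have h2 : shareE (xAllocE s) (.oep e) (.aep e) = 1 := by simp [shareE, xAllocE]
    rw [h1, h2]
    simp only [xAllocUtilE]
    linarith
  · rw [utilE_aun]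
    simp [xAllocUtilE, shareE, xAllocE]
    linarith
  · rw [utilE_aepun]
    simp [xAllocUtilE, shareE, xAllocE]
  · rw [utilE_asat]
    simp [xAllocUtilE, shareE, xAllocE]

theorem utilE_xAllocE_le {M : ℝ} (hφ : ∀ i, (φ i).card ≤ 3) (hM : 5 < M) (hk : 1 ≤ k)
    (s : Fin p → Bool) (A j : AgentE p q k φ) :
    utilE p q k φ M (xAllocE s) A j ≤ xAllocUtilE p q k φ M s A := by
  have hp' : (0 : ℝ) ≤ p := Nat.cast_nonneg _
  have hq' : (0 : ℝ) ≤ q := Nat.cast_nonneg _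
  have hk' : (1 : ℝ) ≤ k := by exact_mod_cast hk
  rcases A with ⟨x | y, b⟩ | ⟨x, b⟩ | i | e | _ | _ | _
  · rw [utilE_aset_inl]
    simp only [xAllocUtilE]
    cases hs : s x <;> rcases j with ⟨x' | y', b'⟩ | ⟨x', b'⟩ | i' | e' | _ | _ | _ <;>
      simp [shareE, xAllocE, hs] <;> split_ifs <;> simp_all
  · rw [utilE_aset_inr]
    simp only [xAllocUtilE]
    have h1 := litShareE_le (xAllocE s) (Sum.inr y, b) j
    have h2 : 0 ≤ occE p q k φ (Sum.inr y, b) := occE_nonneg _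
    by_cases hj : j = .aun
    · subst hj
      rw [litShareE_eq_zero fun e _ => xAllocE_olit_ne s e (by simp) (by simp)]
      simp [shareE, xAllocE]
    · rw [shareE_eq_zero (by simpa [xAllocE] using Ne.symm hj)]
      linarith
  · rw [utilE_ah]
    have h1 := litShareE_le (xAllocE s) (uLit (x, b)) j
    have h2 : 0 ≤ occE p q k φ (uLit (x, b)) := occE_nonneg _
    have h3 := mul_le_mul_of_nonneg_left (shareE_le_one (xAllocE s) (.oh (x, b)) j) h2
    simp only [xAllocUtilE]
    split_ifs with hs
    · by_cases hj : j = .ah (x, b)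
      · rw [shareE_eq_zero (by simp [xAllocE, hs, hj])]
        linarith
      · rw [litShareE_eq_zero fun e he => by
          rw [xAllocE_olit_inl s e he]; simpa using Ne.symm hj]
        linarith
    · linarith
  · rw [utilE_ac]
    simp only [xAllocUtilE]
    have h1 := clauseShareE_le (xAllocE s) i j
    have h2 : ((φ i).card : ℝ) ≤ 3 := by exact_mod_cast hφ i
    by_cases hj : j = .ac i
    · subst hj
      rw [clauseShareE_eq_zero fun e _ => xAllocE_olit_ne s e (by simp) (by simp)]
      simp [shareE, xAllocE]
    · by_cases hj' : j = .aun
      · subst hj'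
        rw [clauseShareE_eq_zero fun e _ => xAllocE_olit_ne s e (by simp) (by simp)]
        simp [shareE, xAllocE]
      · rw [shareE_eq_zero (by simpa [xAllocE] using Ne.symm hj),
          shareE_eq_zero (by simpa [xAllocE] using Ne.symm hj')]
        linarith
  · rw [utilE_aep]
    simp only [xAllocUtilE]
    have h1 := shareE_le_one (xAllocE s) (.olit ⟨e.1, ⟨e.2.1, e.2.2.1⟩⟩) j
    by_cases hj : j = .ac e.1
    · subst hj
      rw [shareE_eq_zero (xAllocE_olit_ne s _ (by simp) (by simp))]
      simp [shareE, xAllocE]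
    · by_cases hj' : j = .aep e
      · subst hj'
        rw [shareE_eq_zero (xAllocE_olit_ne s _ (by simp) (by simp))]
        simp [shareE, xAllocE]
      · rw [shareE_eq_zero (o := .ocl _) (by simpa [xAllocE] using Ne.symm hj),
          shareE_eq_zero (o := .oep _) (by simpa [xAllocE] using Ne.symm hj')]
        linarith
  · rw [utilE_aun]
    simp only [xAllocUtilE]
    rcases j with l | l | i' | e' | _ | _ | _ <;> simp [shareE, xAllocE] <;> linarith
  · rw [utilE_aepun]
    simp only [xAllocUtilE]
    have := mul_le_mul_of_nonneg_left (shareE_le_one (xAllocE s) .oenvy2 j)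
      (by linarith : 0 ≤ M)
    linarith
  · rw [utilE_asat]
    simp only [xAllocUtilE]
    have h1 := sum_shareE_le (xAllocE s) .ocl j
    by_cases hj : ∃ i, j = .ac i
    · obtain ⟨i, rfl⟩ := hj
      simpa [shareE, xAllocE] using hk
    · rw [sum_shareE_eq_zero fun i => by
        simpa [xAllocE] using fun h => hj ⟨i, Eq.symm h⟩]
      rcases j with l | l | i' | e' | _ | _ | _ <;> simp [shareE, xAllocE]
      linarith

/-- `a_un` retains its utility under `xAllocE s` only if it holds `o_envy1` and, unless it also
holds `o_sat`, all compensation and existential variable resources. -/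
theorem aun_holds {M : ℝ} {al : ResE p q k φ → Option (AgentE p q k φ)}
    (hun : 2 * ((q : ℝ) + p + k + 1) + ((q : ℝ) + p + k) ≤ utilE p q k φ M al .aun .aun)
    (h2 : al .oenvy2 ≠ some .aun) :
    al .oenvy1 = some .aun ∧ (al .osat ≠ some .aun →
      (∀ x, al (.ocomp x) = some .aun) ∧ (∀ y, al (.oevar y) = some .aun) ∧
        ∀ i, al (.occomp i) = some .aun) := by
  have hp : (0 : ℝ) ≤ p := Nat.cast_nonneg _
  have hq : (0 : ℝ) ≤ q := Nat.cast_nonneg _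
  have hk : (0 : ℝ) ≤ k := Nat.cast_nonneg _
  have hc := sum_shareE_le al .ocomp .aun
  have he := sum_shareE_le al .oevar .aun
  have hcc := sum_shareE_le al .occomp .aun
  have hN : 0 ≤ (q : ℝ) + p + k + 1 := by linarith
  have hs := mul_le_mul_of_nonneg_left (shareE_le_one al .osat .aun) hN
  have h1 := mul_le_mul_of_nonneg_left (shareE_le_one al .oenvy1 .aun) hN
  rw [utilE_aun, shareE_eq_zero h2] at hun
  refine ⟨?_, fun hsat => ?_⟩
  · by_contra hne
    rw [shareE_eq_zero hne] at hun
    linarith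
  · rw [shareE_eq_zero hsat] at hun
    exact ⟨eq_some_of_le_sum_shareE (by linarith), eq_some_of_le_sum_shareE (by linarith),
      eq_some_of_le_sum_shareE (by linarith)⟩

theorem not_satOnE_utilE_le {M : ℝ} (hφ : ∀ i, (φ i).card ≤ 3)
    (hocc : ∀ (v : VarE p q) (b : Bool), ∃ i, ((v, b) ∈ φ i)) (hM : 5 < M)
    {s : Fin p → Bool} (hs : ¬ SatOnE p q k φ s) {al : ResE p q k φ → Option (AgentE p q k φ)}
    (hal : ∀ A, xAllocUtilE p q k φ M s A ≤ utilE p q k φ M al A A) (A : AgentE p q k φ) :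
    utilE p q k φ M al A A ≤ xAllocUtilE p q k φ M s A := by
  have hpun : al .oenvy2 = some .aepun := by
    have h := hal .aepun
    rw [utilE_aepun] at h
    refine eq_some_of_shareE_pos (pos_of_mul_pos_right (a := M) ?_ (by linarith))
    simp only [xAllocUtilE] at h
    linarith
  obtain ⟨henvy1, hrest⟩ := aun_holds (hal .aun) (by simp [hpun])
  -- false universal literals
  have hfalse (l : ULitE p) (hl : s l.1 ≠ l.2) : al (.oh l) = some (.ah l) ∧
      ∀ e : LitOccE p q k φ, (e.2 : LitE p q) = uLit l → al (.olit e) = some (.ah l) := by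
    have h := hal (.ah l)
    rw [utilE_ah] at h
    simp only [xAllocUtilE, if_neg hl] at h
    have hpos : 0 < occE p q k φ (uLit l) := occE_pos (hocc _ _)
    have h1 := litShareE_le al (uLit l) (.ah l)
    have h2 := mul_le_mul_of_nonneg_left (shareE_le_one al (.oh l) (.ah l)) hpos.le
    refine ⟨eq_some_of_shareE_pos (pos_of_mul_pos_right (a := occE p q k φ (uLit l)) ?_ hpos.le),
      eq_some_of_occE_le ?_⟩ <;> linarith
  have hac (i : Fin k) : M ≤ M * shareE al (.ocl i) (.ac i) +
      (M - 1) * shareE al (.occomp i) (.ac i) + clauseShareE al i (.ac i) := by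
    rw [← utilE_ac]
    exact hal (.ac i)
  have haset (y : Fin q) (b : Bool) : occE p q k φ (Sum.inr y, b) ≤
      occE p q k φ (Sum.inr y, b) * shareE al (.oevar y) (.aset (Sum.inr y, b)) +
        litShareE al (Sum.inr y, b) (.aset (Sum.inr y, b)) := by
    rw [← utilE_aset_inr M]
    exact hal (.aset (Sum.inr y, b))
  have hasat : (k : ℝ) ≤ ∑ i, shareE al (.ocl i) .asat + k * shareE al .osat .asat := by
    have h := hal .asat
    rw [utilE_asat, shareE_eq_zero_of_ne henvy1 (by simp)] at h
    simpa [xAllocUtilE] using h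
  by_cases hsat : al .osat = some .aun
  · refine absurd ?_ hs
    have hcl (i : Fin k) : al (.ocl i) = some .asat := by
      rw [shareE_eq_zero_of_ne hsat (by simp), mul_zero, add_zero] at hasat
      exact eq_some_of_le_sum_shareE hasat i
    have hpick (i : Fin k) : ∃ e : LitOccE p q k φ, e.1 = i ∧ al (.olit e) = some (.ac i) := by
      by_contra! hne
      have h := hac i
      rw [clauseShareE_eq_zero hne, shareE_eq_zero_of_ne (hcl i) (by simp)] at h
      have := mul_le_mul_of_nonneg_left (shareE_le_one al (.occomp i) (.ac i))
        (by linarith : 0 ≤ M - 1)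
      linarith
    have hvar (y : Fin q) (b : Bool) (e : LitOccE p q k φ)
        (he : (e.2 : LitE p q) = (Sum.inr y, b)) (hel : al (.olit e) = some (.ac e.1)) :
        al (.oevar y) = some (.aset (Sum.inr y, b)) := by
      by_contra hne
      have h := haset y b
      rw [shareE_eq_zero hne, mul_zero, zero_add] at h
      have := eq_some_of_occE_le h e he
      simp [hel] at this
    refine ⟨fun y => decide (al (.oevar y) = some (.aset (Sum.inr y, true))), fun i => ?_⟩
    obtain ⟨⟨i', ⟨⟨x | y, b⟩, hl⟩⟩, rfl, he⟩ := hpick i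
    · refine ⟨_, hl, ?_⟩
      by_contra hne
      have := (hfalse (x, b) hne).2 ⟨i', ⟨_, hl⟩⟩ rfl
      simp [he] at this
    · refine ⟨_, hl, ?_⟩
      have := hvar y b ⟨i', ⟨_, hl⟩⟩ rfl he
      cases b <;> simp [this]
  · obtain ⟨hcomp, hevar, hccomp⟩ := hrest hsat
    have hcl (i : Fin k) : al (.ocl i) = some (.ac i) := by
      by_contra hne
      have h := hac i
      rw [shareE_eq_zero hne, shareE_eq_zero_of_ne (hccomp i) (by simp)] at h
      have h1 := clauseShareE_le al i (.ac i)
      have h2 : ((φ i).card : ℝ) ≤ 3 := by exact_mod_cast hφ i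
      linarith
    have hexlit (y : Fin q) (b : Bool) (e : LitOccE p q k φ)
        (he : (e.2 : LitE p q) = (Sum.inr y, b)) :
        al (.olit e) = some (.aset (Sum.inr y, b)) := by
      have h := haset y b
      rw [shareE_eq_zero_of_ne (hevar y) (by simp), mul_zero, zero_add] at h
      exact eq_some_of_occE_le h e he
    -- the agents `a_set(x)` and `a_set(¬x)` share `o_x` and one helper resource
    have hun (x : Fin p) (b : Bool) :
        1 ≤ shareE al (.ovar x) (.aset (Sum.inl x, b)) +
          shareE al (.oh (x, s x)) (.aset (Sum.inl x, b)) ∧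
        utilE p q k φ M al (.aset (Sum.inl x, b)) (.aset (Sum.inl x, b)) =
          shareE al (.ovar x) (.aset (Sum.inl x, b)) +
            shareE al (.oh (x, s x)) (.aset (Sum.inl x, b)) := by
      have h := hal (.aset (Sum.inl x, b))
      have h1 := (hfalse (x, !s x) (by simp)).1
      have h2 : utilE p q k φ M al (.aset (Sum.inl x, b)) (.aset (Sum.inl x, b)) =
          shareE al (.ovar x) (.aset (Sum.inl x, b)) +
            shareE al (.oh (x, s x)) (.aset (Sum.inl x, b)) := by
        rw [utilE_aset_inl, shareE_eq_zero_of_ne (hcomp x) (by simp)]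
        cases hsx : s x <;> simp only [hsx, Bool.not_true, Bool.not_false] at h1 <;>
          rw [shareE_eq_zero_of_ne h1 (by simp)] <;> ring
      refine ⟨?_, h2⟩
      rw [h2] at h
      exact h
    have hboth (x : Fin p) (b : Bool) (hb : al (.ovar x) = some (.aset (Sum.inl x, b))) :
        al (.oh (x, s x)) = some (.aset (Sum.inl x, !b)) := by
      have h := (hun x (!b)).1
      rw [shareE_eq_zero_of_ne hb (by simp)] at h
      exact eq_some_of_shareE_pos (by linarith)
    have hplace (x : Fin p) : ∃ b, al (.ovar x) = some (.aset (Sum.inl x, b)) ∧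
        al (.oh (x, s x)) = some (.aset (Sum.inl x, !b)) := by
      by_contra! hne
      have hv (b : Bool) : al (.ovar x) ≠ some (.aset (Sum.inl x, b)) :=
        fun h => hne b h (hboth x b h)
      have h (b : Bool) : al (.oh (x, s x)) = some (.aset (Sum.inl x, b)) := by
        have h := (hun x b).1
        rw [shareE_eq_zero (hv b)] at h
        exact eq_some_of_shareE_pos (by linarith)
      simpa using (h true).symm.trans (h false)
    have htrue (l : ULitE p) (hl : s l.1 = l.2) : al (.oh l) ≠ some (.ah l) := by
      obtain ⟨b, -, hb⟩ := hplace l.1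
      rw [hl] at hb
      simp [hb]
    have hunlit (x : Fin p) (b : Bool) (e : LitOccE p q k φ)
        (he : (e.2 : LitE p q) = (Sum.inl x, b)) : al (.olit e) = some (.ah (x, b)) := by
      by_cases hl : s x = b
      · have h := hal (.ah (x, b))
        rw [utilE_ah, shareE_eq_zero (htrue (x, b) hl)] at h
        simp only [xAllocUtilE, if_pos hl, mul_zero, zero_add] at h
        exact eq_some_of_occE_le h e he
      · exact (hfalse (x, b) hl).2 e he
    have hlit (e : LitOccE p q k φ) (hset : ∀ l, A ≠ .aset l) (hh : ∀ l, A ≠ .ah l) :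
        al (.olit e) ≠ some A := by
      rcases h : (e.2 : LitE p q) with ⟨x | y, b⟩
      · rw [hunlit x b e h]; simpa using (hh (x, b)).symm
      · rw [hexlit y b e h]; simpa using (hset (Sum.inr y, b)).symm
    rcases A with ⟨x | y, b⟩ | l | i | e | _ | _ | _
    · rw [(hun x b).2]
      obtain ⟨b', hb', hb''⟩ := hplace x
      simp only [xAllocUtilE, shareE, hb', hb'']
      cases b <;> cases b' <;> simp
    · rw [utilE_aset_inr, shareE_eq_zero_of_ne (hevar y) (by simp), mul_zero, zero_add]
      exact litShareE_le _ _ _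
    · rw [utilE_ah]
      have h1 := litShareE_le al (uLit l) (.ah l)
      have h2 : 0 ≤ occE p q k φ (uLit l) := occE_nonneg _
      have h3 := mul_le_mul_of_nonneg_left (shareE_le_one al (.oh l) (.ah l)) h2
      simp only [xAllocUtilE]
      split_ifs with hl
      · rw [shareE_eq_zero (htrue l hl)]
        linarith
      · linarith
    · rw [utilE_ac, clauseShareE_eq_zero fun e _ => hlit e (by simp) (by simp),
        shareE_eq_one (hcl i), shareE_eq_zero_of_ne (hccomp i) (by simp)]
      simp [xAllocUtilE]
    · rw [utilE_aep, shareE_eq_zero (hlit _ (by simp) (by simp)),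
        shareE_eq_zero_of_ne (hcl _) (by simp)]
      have := mul_le_mul_of_nonneg_left (shareE_le_one al (.oep e) (.aep e))
        (by linarith : 0 ≤ M)
      simp only [xAllocUtilE]
      linarith
    · rw [utilE_aun, shareE_eq_zero hsat, shareE_eq_one henvy1,
        shareE_eq_zero_of_ne hpun (by simp)]
      have hc := sum_shareE_le al .ocomp .aun
      have he := sum_shareE_le al .oevar .aun
      have hcc := sum_shareE_le al .occomp .aun
      simp only [xAllocUtilE]
      linarith
    · rw [utilE_aepun, shareE_eq_one hpun]
      simp [xAllocUtilE]
    · rw [utilE_asat, sum_shareE_eq_zero fun i => by simp [hcl i],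
        shareE_eq_zero_of_ne henvy1 (by simp)]
      have := mul_le_mul_of_nonneg_left (shareE_le_one al .osat .asat)
        (Nat.cast_nonneg k : (0 : ℝ) ≤ k)
      simp only [xAllocUtilE]
      linarith

theorem exists_EEF_of_not_satOnE {M : ℝ} (hφ : ∀ i, (φ i).card ≤ 3)
    (hocc : ∀ (v : VarE p q) (b : Bool), ∃ i, ((v, b) ∈ φ i)) (hM : 5 < M)
    {s : Fin p → Bool} (hs : ¬ SatOnE p q k φ s) :
    ∃ al : ResE p q k φ → Option (AgentE p q k φ),
      ParetoOptE p q k φ M al ∧ EnvyFreeE p q k φ M al := by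
  have hk : 1 ≤ k := by
    by_contra hk
    obtain rfl : k = 0 := by omega
    exact hs ⟨fun _ => true, fun i => i.elim0⟩
  refine ⟨xAllocE s, ?_, fun i j => ?_⟩
  · rintro ⟨al, hle, A, hlt⟩
    refine absurd hlt (not_lt.2 ?_)
    exact (not_satOnE_utilE_le hφ hocc hM hs
      (fun B => (xAllocUtilE_le_utilE s B).trans (hle B)) A).trans (xAllocUtilE_le_utilE s A)
  · exact (utilE_xAllocE_le hφ hM hk s i j).trans (xAllocUtilE_le_utilE s i)

end UnsatToEEF

section EEFToUnsat

variable {p q k : ℕ} {φ : Fin k → Finset (LitE p q)}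

/-- The rearrangement of the allocation `al` by which `a_un` gives up all its resources except
`o_envy1` in exchange for `o_sat`; `s` and `t` are the assignments of the universal and
existential variables, and `c` picks a literal of each clause. -/
def satAllocE (al : ResE p q k φ → Option (AgentE p q k φ)) (s : Fin p → Bool)
    (t : Fin q → Bool) (c : ∀ i, {l : LitE p q // l ∈ φ i}) :
    ResE p q k φ → Option (AgentE p q k φ)
  | .ovar x => al (.ovar x)
  | .ocomp x => al (.oh (x, s x))
  | .oh l => if s l.1 = l.2 then some (.ah l) else al (.oh l)
  | .oevar y => some (.aset (Sum.inr y, t y))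
  | .ocl _ => some .asat
  | .occomp i => some (.ac i)
  | .olit e => if e.2 = c e.1 then some (.ac e.1) else al (.olit e)
  | .oep e => al (.oep e)
  | .osat => some .aun
  | .oenvy1 => some .aun
  | .oenvy2 => al .oenvy2

theorem litShareE_le_satAllocE {al : ResE p q k φ → Option (AgentE p q k φ)}
    {s : Fin p → Bool} {t : Fin q → Bool} {c : ∀ i, {l : LitE p q // l ∈ φ i}}
    {l : LitE p q} (h : ∀ i, (c i : LitE p q) ≠ l) (j : AgentE p q k φ) :
    litShareE al l j ≤ litShareE (satAllocE al s t c) l j := by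
  refine Finset.sum_le_sum fun e _ => ?_
  split_ifs with he
  · have : e.2 ≠ c e.1 := fun hc => h e.1 (hc ▸ he)
    simp [shareE, satAllocE, this]
  · exact le_rfl

theorem clauseShareE_add_one_le_satAllocE {al : ResE p q k φ → Option (AgentE p q k φ)}
    {s : Fin p → Bool} {t : Fin q → Bool} {c : ∀ i, {l : LitE p q // l ∈ φ i}} {i : Fin k}
    (h : al (.olit ⟨i, c i⟩) ≠ some (.ac i)) :
    clauseShareE al i (.ac i) + 1 ≤ clauseShareE (satAllocE al s t c) i (.ac i) := by
  have hsum : (∑ e : LitOccE p q k φ, if e = ⟨i, c i⟩ then (1 : ℝ) else 0) = 1 := by simp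
  rw [clauseShareE, clauseShareE, ← hsum, ← Finset.sum_add_distrib]
  refine Finset.sum_le_sum fun e _ => ?_
  by_cases he : e = ⟨i, c i⟩
  · subst he
    simp [shareE, satAllocE, h]
  · obtain ⟨i', l⟩ := e
    by_cases hi : i' = i
    · subst hi
      have hl : l ≠ c i' := fun hl => he (by rw [hl])
      simp [shareE, satAllocE, hl]
    · simp [he, hi]

/-- In an envy-free allocation, the resources that `a_un` and `a^ep_un` compete for are placed as
in an `X_∀`-allocation, and so are all `o_c`. -/
theorem EnvyFreeE.placement {M : ℝ} (hφ : ∀ i, (φ i).card ≤ 3) (hM : 5 < M)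
    {al : ResE p q k φ → Option (AgentE p q k φ)} (hef : EnvyFreeE p q k φ M al)
    (h2 : al .oenvy2 = some .aepun) :
    al .oenvy1 = some .aun ∧ al .osat ≠ some .aun ∧ (∀ x, al (.ocomp x) = some .aun) ∧
      (∀ y, al (.oevar y) = some .aun) ∧ (∀ i, al (.occomp i) = some .aun) ∧
      ∀ i, al (.ocl i) = some (.ac i) := by
  have hun : 2 * ((q : ℝ) + p + k + 1) + ((q : ℝ) + p + k) ≤ utilE p q k φ M al .aun .aun := by
    refine le_trans ?_ (hef .aun .aepun)
    have hp : (0 : ℝ) ≤ p := Nat.cast_nonneg _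
    have hq : (0 : ℝ) ≤ q := Nat.cast_nonneg _
    have hk : (0 : ℝ) ≤ k := Nat.cast_nonneg _
    have h (o : ResE p q k φ) := shareE_nonneg al o .aepun
    have hN : 0 ≤ (q : ℝ) + p + k + 1 := by linarith
    have hc := sum_shareE_nonneg al .ocomp .aepun
    have he := sum_shareE_nonneg al .oevar .aepun
    have hcc := sum_shareE_nonneg al .occomp .aepun
    have hs := mul_nonneg hN (h .osat)
    have h1 := mul_nonneg hN (h .oenvy1)
    rw [utilE_aun, shareE_eq_one h2]
    linarith
  obtain ⟨h1, hrest⟩ := aun_holds hun (by simp [h2])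
  have hsat : al .osat ≠ some .aun := by
    intro hsat
    have h := hef .asat .aun
    rw [utilE_asat, utilE_asat, shareE_eq_one hsat, shareE_eq_one h1,
      shareE_eq_zero_of_ne hsat (by simp), shareE_eq_zero_of_ne h1 (by simp)] at h
    have hcl := sum_shareE_le al .ocl .asat
    have hcl' := sum_shareE_nonneg al .ocl .aun
    linarith
  obtain ⟨hcomp, hevar, hccomp⟩ := hrest hsat
  refine ⟨h1, hsat, hcomp, hevar, hccomp, fun i => ?_⟩
  by_contra hne
  have h := hef (.ac i) .aun
  rw [utilE_ac, utilE_ac, shareE_eq_one (hccomp i), shareE_eq_zero hne,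
    shareE_eq_zero_of_ne (hccomp i) (by simp)] at h
  have h3 := clauseShareE_nonneg al i .aun
  have h4 := clauseShareE_le al i (.ac i)
  have h5 : ((φ i).card : ℝ) ≤ 3 := by exact_mod_cast hφ i
  have h6 := mul_nonneg (by linarith : 0 ≤ M) (shareE_nonneg al (.ocl i) .aun)
  linarith

/-- Under a Pareto-optimal allocation, a resource is wasted on its holder only if no agent has a
use for it. -/
theorem ParetoOptE.coeffE_le_zero {M : ℝ} {al : ResE p q k φ → Option (AgentE p q k φ)}
    (hpo : ParetoOptE p q k φ M al) {o : ResE p q k φ}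
    (ho : ∀ A, al o = some A → coeffE p q k φ M A o ≤ 0) (B : AgentE p q k φ) :
    coeffE p q k φ M B o ≤ 0 := by
  by_contra! hB
  have hle (A : AgentE p q k φ) (o' : ResE p q k φ) :
      (if al o' = some A then coeffE p q k φ M A o' else 0) ≤
        if Function.update al o (some B) o' = some A then coeffE p q k φ M A o' else 0 := by
    by_cases h : o' = o
    · subst h
      rw [Function.update_self]
      have := ho A
      split_ifs with h1 h2 h2
      · exact le_rfl
      · exact this h1
      · obtain rfl := Option.some.inj h2
        exact hB.le
      · exact le_rfl
    · rw [Function.update_of_ne h]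
  refine hpo ⟨Function.update al o (some B), fun A => Finset.sum_le_sum fun o' _ => hle A o', B,
    Finset.sum_lt_sum (fun o' _ => hle B o') ⟨o, Finset.mem_univ _, ?_⟩⟩
  rw [Function.update_self, if_pos rfl, if_neg fun h => not_lt.2 (ho B h) hB]
  exact hB

theorem oenvy2_eq_some_aepun {M : ℝ} (hM : 5 < M)
    {al : ResE p q k φ → Option (AgentE p q k φ)} (hpo : ParetoOptE p q k φ M al)
    (hef : EnvyFreeE p q k φ M al) : al .oenvy2 = some .aepun := by
  by_contra hne
  by_cases hun : al .oenvy2 = some .aun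
  · have h := hef .aepun .aun
    rw [utilE_aepun, utilE_aepun, shareE_eq_one hun, shareE_eq_zero hne] at h
    linarith
  · have h := hpo.coeffE_le_zero (o := .oenvy2) (fun A hA => ?_) .aepun
    · simp [coeffE, coeffAuxE] at h
      linarith
    · cases A <;> first | exact absurd hA hne | exact absurd hA hun | simp [coeffE, coeffAuxE]

/-- In an envy-free allocation, some helper resource of each universal variable `x` is held by
`a_set(x)` or `a_set(¬x)`. -/
theorem EnvyFreeE.exists_oh {M : ℝ} {al : ResE p q k φ → Option (AgentE p q k φ)}
    (hef : EnvyFreeE p q k φ M al) {x : Fin p} (hcomp : al (.ocomp x) = some .aun) :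
    ∃ b b' : Bool, al (.oh (x, b)) = some (.aset (Sum.inl x, b')) := by
  by_contra! hne
  have hv (b : Bool) : al (.ovar x) = some (.aset (Sum.inl x, b)) := by
    have h := hef (.aset (Sum.inl x, b)) .aun
    rw [utilE_aset_inl, utilE_aset_inl, shareE_eq_one hcomp,
      shareE_eq_zero_of_ne hcomp (by simp), shareE_eq_zero (hne true b),
      shareE_eq_zero (hne false b)] at h
    have h1 := shareE_nonneg al (.ovar x) .aun
    have h2 := shareE_nonneg al (.oh (x, true)) .aun
    have h3 := shareE_nonneg al (.oh (x, false)) .aun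
    exact eq_some_of_shareE_pos (by linarith)
  simpa using (hv true).symm.trans (hv false)

theorem exists_not_satOnE_of_EEF {M : ℝ} (hφ : ∀ i, (φ i).card ≤ 3) (hM : 5 < M)
    {al : ResE p q k φ → Option (AgentE p q k φ)} (hpo : ParetoOptE p q k φ M al)
    (hef : EnvyFreeE p q k φ M al) : ∃ s : Fin p → Bool, ¬ SatOnE p q k φ s := by
  have henvy2 := oenvy2_eq_some_aepun hM hpo hef
  obtain ⟨henvy1, hsat, hcomp, hevar, hccomp, hcl⟩ := hef.placement hφ hM henvy2
  choose s r hsr using fun x => hef.exists_oh (hcomp x)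
  refine ⟨s, ?_⟩
  rintro ⟨t, ht⟩
  have hc' (i : Fin k) : ∃ l : {l : LitE p q // l ∈ φ i}, Sum.elim s t l.1.1 = l.1.2 := by
    obtain ⟨l, hl, h⟩ := ht i
    exact ⟨⟨l, hl⟩, h⟩
  choose c hc using hc'
  have hc_ne {v : VarE p q} {b : Bool} (hb : Sum.elim s t v ≠ b) (i : Fin k) :
      (c i : LitE p q) ≠ (v, b) := by
    intro h
    have := hc i
    rw [h] at this
    exact hb this
  have hexlit (y : Fin q) (b : Bool) (e : LitOccE p q k φ)
      (he : (e.2 : LitE p q) = (Sum.inr y, b)) : al (.olit e) = some (.aset (Sum.inr y, b)) := by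
    have h := hef (.aset (Sum.inr y, b)) .aun
    rw [utilE_aset_inr, utilE_aset_inr, shareE_eq_one (hevar y),
      shareE_eq_zero_of_ne (hevar y) (by simp)] at h
    have := litShareE_nonneg al (Sum.inr y, b) .aun
    exact eq_some_of_occE_le (by linarith) e he
  have hunlit (x : Fin p) (e : LitOccE p q k φ)
      (he : (e.2 : LitE p q) = (Sum.inl x, s x)) : al (.olit e) = some (.ah (x, s x)) := by
    have h := hef (.ah (x, s x)) (.aset (Sum.inl x, r x))
    rw [utilE_ah, utilE_ah, shareE_eq_one (hsr x),
      shareE_eq_zero_of_ne (hsr x) (by simp)] at h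
    have := litShareE_nonneg al (uLit (x, s x)) (.aset (Sum.inl x, r x))
    exact eq_some_of_occE_le (l := uLit (x, s x)) (by linarith) e he
  have hclit (e : LitOccE p q k φ) (he : e.2 = c e.1) {A : AgentE p q k φ}
      (hset : ∀ l, A ≠ .aset l) (hh : ∀ l, A ≠ .ah l) : al (.olit e) ≠ some A := by
    have h := hc e.1
    rw [← he] at h
    rcases hl : (e.2 : LitE p q) with ⟨x | y, b⟩
    · rw [hl] at h
      obtain rfl : s x = b := h
      rw [hunlit x e hl]
      simpa using (hh (x, s x)).symm
    · rw [hexlit y b e hl]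
      simpa using (hset (Sum.inr y, b)).symm
  have haun : utilE p q k φ M al .aun .aun <
      utilE p q k φ M (satAllocE al s t c) .aun .aun := by
    rw [utilE_aun, utilE_aun, shareE_eq_zero hsat, shareE_eq_one henvy1,
      shareE_eq_zero_of_ne henvy2 (by simp),
      shareE_eq_one (al := satAllocE al s t c) (o := .osat) rfl,
      shareE_eq_one (al := satAllocE al s t c) (o := .oenvy1) rfl,
      shareE_eq_zero_of_ne (al := satAllocE al s t c) (o := .oenvy2) henvy2 (by simp)]
    have h1 := sum_shareE_le al .ocomp .aun
    have h2 := sum_shareE_le al .oevar .aun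
    have h3 := sum_shareE_le al .occomp .aun
    have h4 := sum_shareE_nonneg (satAllocE al s t c) .ocomp .aun
    have h5 := sum_shareE_nonneg (satAllocE al s t c) .oevar .aun
    have h6 := sum_shareE_nonneg (satAllocE al s t c) .occomp .aun
    linarith
  refine hpo ⟨satAllocE al s t c, fun A => ?_, .aun, haun⟩
  rcases A with ⟨x | y, b⟩ | ⟨x, b⟩ | i | e | _ | _ | _
  · rw [utilE_aset_inl, utilE_aset_inl, shareE_eq_zero_of_ne (hcomp x) (by simp)]
    have hv : shareE (satAllocE al s t c) (.ovar x) (.aset (Sum.inl x, b)) =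
        shareE al (.ovar x) (.aset (Sum.inl x, b)) := rfl
    have hk : shareE (satAllocE al s t c) (.ocomp x) (.aset (Sum.inl x, b)) =
        shareE al (.oh (x, s x)) (.aset (Sum.inl x, b)) := rfl
    have hh (b' : Bool) (hb' : s x ≠ b') :
        shareE (satAllocE al s t c) (.oh (x, b')) (.aset (Sum.inl x, b)) =
          shareE al (.oh (x, b')) (.aset (Sum.inl x, b)) := by
      simp [shareE, satAllocE, hb']
    have h (b' : Bool) :=
      shareE_nonneg (satAllocE al s t c) (.oh (x, b')) (.aset (Sum.inl x, b))
    rw [hv, hk]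
    cases hs : s x
    · rw [hh true (by simp [hs])]
      linarith [h false]
    · rw [hh false (by simp [hs])]
      linarith [h true]
  · rw [utilE_aset_inr, utilE_aset_inr, shareE_eq_zero_of_ne (hevar y) (by simp)]
    have hpos : 0 ≤ occE p q k φ (Sum.inr y, b) := occE_nonneg _
    by_cases hb : t y = b
    · have h1 := litShareE_le al (Sum.inr y, b) (.aset (Sum.inr y, b))
      have h2 := litShareE_nonneg (satAllocE al s t c) (Sum.inr y, b) (.aset (Sum.inr y, b))
      rw [shareE_eq_one (al := satAllocE al s t c) (o := .oevar y) (by simp [satAllocE, hb])]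
      linarith
    · have h1 := litShareE_le_satAllocE (al := al) (s := s) (t := t) (hc_ne (v := Sum.inr y) hb)
        (.aset (Sum.inr y, b))
      have h2 := mul_nonneg hpos
        (shareE_nonneg (satAllocE al s t c) (.oevar y) (.aset (Sum.inr y, b)))
      linarith
  · rw [utilE_ah, utilE_ah]
    by_cases hb : s x = b
    · have h1 := litShareE_le al (uLit (x, b)) (.ah (x, b))
      have h2 := litShareE_nonneg (satAllocE al s t c) (uLit (x, b)) (.ah (x, b))
      rw [shareE_eq_one (al := satAllocE al s t c) (o := .oh (x, b)) (by simp [satAllocE, hb]),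
        shareE_eq_zero_of_ne (hb ▸ hsr x) (by simp)]
      linarith
    · have h1 := litShareE_le_satAllocE (al := al) (s := s) (t := t) (hc_ne (v := Sum.inl x) hb)
        (.ah (x, b))
      have h2 : shareE (satAllocE al s t c) (.oh (x, b)) (.ah (x, b)) =
          shareE al (.oh (x, b)) (.ah (x, b)) := by simp [shareE, satAllocE, hb]
      rw [h2]
      exact add_le_add le_rfl h1
  · have h := clauseShareE_add_one_le_satAllocE (s := s) (t := t) (c := c) (i := i)
      (hclit ⟨i, c i⟩ rfl (by simp) (by simp))
    rw [utilE_ac, utilE_ac, shareE_eq_one (hcl i), shareE_eq_zero_of_ne (hccomp i) (by simp),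
      shareE_eq_one (al := satAllocE al s t c) (o := .occomp i) rfl,
      shareE_eq_zero_of_ne (al := satAllocE al s t c) (o := .ocl i) rfl (by simp)]
    linarith
  · rw [utilE_aep, utilE_aep, shareE_eq_zero_of_ne (hcl _) (by simp),
      shareE_eq_zero_of_ne (al := satAllocE al s t c) (o := .ocl _) rfl (by simp)]
    refine add_le_add (add_le_add le_rfl ?_) le_rfl
    by_cases he : (⟨e.2.1, e.2.2.1⟩ : {l : LitE p q // l ∈ φ e.1}) = c e.1
    · rw [shareE_eq_zero (hclit _ he (by simp) (by simp))]
      exact shareE_nonneg _ _ _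
    · simp [shareE, satAllocE, he]
  · exact haun.le
  · rw [utilE_aepun, utilE_aepun]
    rfl
  · rw [utilE_asat, utilE_asat, sum_shareE_eq_zero fun i => by simp [hcl i],
      shareE_eq_zero_of_ne henvy1 (by simp)]
    have h1 := mul_le_mul_of_nonneg_left (shareE_le_one al .osat .asat)
      (Nat.cast_nonneg k : (0 : ℝ) ≤ k)
    simp [shareE, satAllocE] at h1 ⊢
    linarith

end EEFToUnsat

/-- The constructed EEF-EXISTENCE-ADDITIVE instance `I'` admits an allocation that is
both Pareto-optimal and envy-free if and only if there exists an assignment of the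
universal variables on which the formula `C` is not satisfiable (i.e. iff the
∀∃3CNF instance is false). -/
theorem EEF_exists_iff (p q k : ℕ) (φ : Fin k → Finset (LitE p q))
    (hφ : ∀ i, (φ i).card ≤ 3)
    (hocc : ∀ (v : VarE p q) (b : Bool), ∃ i, ((v, b) ∈ φ i))
    (M : ℝ) (hM : nonMSumE p q k φ < M) :
    (∃ al : ResE p q k φ → Option (AgentE p q k φ),
        ParetoOptE p q k φ M al ∧ EnvyFreeE p q k φ M al) ↔
      ∃ s : Fin p → Bool, ¬ SatOnE p q k φ s := by
  have h5 := five_lt_of_nonMSumE_lt hM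
  constructor
  · rintro ⟨al, hpo, hef⟩
    exact exists_not_satOnE_of_EEF hφ h5 hpo hef
  · rintro ⟨s, hs⟩
    exact exists_EEF_of_not_satOnE hφ hocc h5 hs
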